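/- arXiv:2204.10363 — 11 statements merged into one kernel-verified Lean document; each statement's English description precedes it below -/
import Mathlib

section
/- For every d ≥ 1 and every word b = (b₁,…,b_d) ∈ {0,1}^d, there exists a polynomial P in five variables over ℂ such that for every pair (A₀, A₁) of 2×2 complex matrices, Tr(A_{b₁}⋯A_{b_d}) = P(Tr(A₀), Tr(A₁), Tr(A₀²), Tr(A₀A₁), Tr(A₁²)). -/
open Matrix

/-- The fundamental trace invariants of a pair of `2×2` matrices. -/
def fundamentalTraces (A : Fin 2 → Matrix (Fin 2) (Fin 2) ℂ) : Fin 5 → ℂ :=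
  ![(A 0).trace, (A 1).trace, (A 0 * A 0).trace, (A 0 * A 1).trace, (A 1 * A 1).trace]

/-- Cayley–Hamilton for `2×2` matrices, with the determinant written in terms of traces. -/
theorem mul_self_eq_trace_smul_sub (M : Matrix (Fin 2) (Fin 2) ℂ) :
    M * M = M.trace • M - ((1 / 2) * (M.trace ^ 2 - (M * M).trace)) • 1 := by
  ext i j
  fin_cases i <;> fin_cases j <;> simp [mul_apply, trace_fin_two] <;> ring

/-- The polarized Cayley–Hamilton identity for `2×2` matrices. -/
theorem mul_comm_eq_trace_smul (M N : Matrix (Fin 2) (Fin 2) ℂ) :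
    N * M = -(M * N) + N.trace • M + M.trace • N
      + ((M * N).trace - M.trace * N.trace) • 1 := by
  ext i j
  fin_cases i <;> fin_cases j <;> simp [mul_apply, trace_fin_two] <;> ring

/-- The sandwiched product `N * M * N` as a combination of `1`, `M` and `N`. -/
theorem mul_mul_self_eq_trace_smul (M N : Matrix (Fin 2) (Fin 2) ℂ) :
    N * (M * N) = ((1 / 2) * (N.trace ^ 2 - (N * N).trace)) • M + (M * N).trace • N
      - (M.trace * ((1 / 2) * (N.trace ^ 2 - (N * N).trace))) • 1 := by
  ext i j
  fin_cases i <;> fin_cases j <;> simp [mul_apply, trace_fin_two] <;> ring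

open MvPolynomial in
/-- Every word in two `2×2` matrices is a combination of `1`, `A 0`, `A 1` and `A 0 * A 1` whose
coefficients are polynomials in the fundamental traces. -/
theorem exists_word_eq_combination (w : List (Fin 2)) :
    ∃ p q r s : MvPolynomial (Fin 5) ℂ, ∀ A : Fin 2 → Matrix (Fin 2) (Fin 2) ℂ,
      (w.map A).prod = eval (fundamentalTraces A) p • 1 + eval (fundamentalTraces A) q • A 0
        + eval (fundamentalTraces A) r • A 1 + eval (fundamentalTraces A) s • (A 0 * A 1) := by
  induction w with
  | nil => exact ⟨1, 0, 0, 0, fun A => by simp⟩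
  | cons a w ih =>
    obtain ⟨p, q, r, s, h⟩ := ih
    match a with
    | 0 =>
      refine ⟨-(C (1 / 2) * (X 0 ^ 2 - X 2)) * q, p + X 0 * q,
        -(C (1 / 2) * (X 0 ^ 2 - X 2)) * s, r + X 0 * s, fun A => ?_⟩
      rw [List.map_cons, List.prod_cons, h]
      simp only [mul_add, mul_smul_comm, mul_one, ← mul_assoc]
      rw [mul_self_eq_trace_smul_sub (A 0)]
      simp only [map_add, map_mul, map_sub, map_neg, map_pow, eval_X, eval_C,
        sub_mul, smul_mul_assoc, one_mul]
      simp only [fundamentalTraces, cons_val]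
      module
    | 1 =>
      refine ⟨(X 3 - X 0 * X 1) * q - (C (1 / 2) * (X 1 ^ 2 - X 4)) * (r + X 0 * s),
        X 1 * q + (C (1 / 2) * (X 1 ^ 2 - X 4)) * s,
        p + X 0 * q + X 1 * r + X 3 * s, -q, fun A => ?_⟩
      rw [List.map_cons, List.prod_cons, h]
      simp only [mul_add, mul_smul_comm, mul_one]
      rw [mul_self_eq_trace_smul_sub (A 1), mul_mul_self_eq_trace_smul (A 0) (A 1),
        mul_comm_eq_trace_smul (A 0) (A 1)]
      simp only [map_add, map_mul, map_sub, map_neg, map_pow, eval_X, eval_C]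
      simp only [fundamentalTraces, cons_val]
      module

/-- Every trace word in two 2×2 matrices is a polynomial in the five fundamental
trace invariants `Tr(A₀), Tr(A₁), Tr(A₀²), Tr(A₀A₁), Tr(A₁²)`. -/
theorem trace_word_polynomial (d : ℕ) (hd : 1 ≤ d) (b : Fin d → Fin 2) :
    ∃ P : MvPolynomial (Fin 5) ℂ,
      ∀ A : Fin 2 → Matrix (Fin 2) (Fin 2) ℂ,
        ((List.ofFn fun ℓ => A (b ℓ)).prod).trace
          = MvPolynomial.eval
              ![(A 0).trace, (A 1).trace, (A 0 * A 0).trace, (A 0 * A 1).trace,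
                (A 1 * A 1).trace] P := by
  obtain ⟨p, q, r, s, h⟩ := exists_word_eq_combination (List.ofFn b)
  refine ⟨p * 2 + q * MvPolynomial.X 0 + r * MvPolynomial.X 1 + s * MvPolynomial.X 3,
    fun A => ?_⟩
  have hA := congrArg trace (h A)
  rw [List.map_ofFn] at hA
  simpa [Function.comp_def, fundamentalTraces] using hA
end

section
/- The five polynomial functions on pairs of 2×2 complex matrices given by (A₀,A₁) ↦ Tr(A₀), Tr(A₁), Tr(A₀²), Tr(A₀A₁), Tr(A₁²) are algebraically independent over ℂ: if P is a polynomial in five variables over ℂ such that P(Tr(A₀), Tr(A₁), Tr(A₀²), Tr(A₀A₁), Tr(A₁²)) = 0 for all 2×2 complex matrices A₀, A₁, then P is the zero polynomial. -/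
open Matrix

/-- Every point of `ℂ⁵` is the tuple of trace invariants of some pair of 2×2 matrices. -/
theorem exists_trace_invariants_eq (a b c d e : ℂ) :
    ∃ A₀ A₁ : Matrix (Fin 2) (Fin 2) ℂ, A₀.trace = a ∧ A₁.trace = b ∧
      (A₀ * A₀).trace = c ∧ (A₀ * A₁).trace = d ∧ (A₁ * A₁).trace = e := by
  obtain ⟨u, hu⟩ := IsAlgClosed.exists_pow_nat_eq ((e - b ^ 2 / 2) / 2) two_pos
  refine ⟨!![a / 2, 1; (c - a ^ 2 / 2) / 2, a / 2],
    !![b / 2 + u, 0; d - a * b / 2, b / 2 - u], ?_, ?_, ?_, ?_, ?_⟩ <;>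
    simp only [mul_fin_two, trace_fin_two_of]
  · ring
  · ring
  · ring
  · ring
  · linear_combination 2 * hu

/-- The five fundamental trace invariants of a pair of 2×2 complex matrices are
algebraically independent over ℂ. -/
theorem trace_invariants_algebraically_independent (P : MvPolynomial (Fin 5) ℂ)
    (h : ∀ A₀ A₁ : Matrix (Fin 2) (Fin 2) ℂ,
      MvPolynomial.eval
        ![A₀.trace, A₁.trace, (A₀ * A₀).trace, (A₀ * A₁).trace, (A₁ * A₁).trace] P = 0) :
    P = 0 := by
  refine MvPolynomial.funext fun x => ?_
  obtain ⟨A₀, A₁, h₀, h₁, h₀₀, h₀₁, h₁₁⟩ :=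
    exists_trace_invariants_eq (x 0) (x 1) (x 2) (x 3) (x 4)
  have hx : ![x 0, x 1, x 2, x 3, x 4] = x := by
    ext i
    fin_cases i <;> rfl
  have hP := h A₀ A₁
  rw [h₀, h₁, h₀₀, h₀₁, h₁₁, hx] at hP
  rw [hP, map_zero]
end

section
/- For any 2×2 complex matrices A₀, A₁, A₂, A₃ and any natural number k, the following identity holds: Tr(A₁A₂A₀A₃A₀^k) + Tr(A₂A₃A₀A₁A₀^k) + Tr(A₃A₁A₀A₂A₀^k) = Tr(A₁A₀A₂A₃A₀^k) + Tr(A₂A₀A₃A₁A₀^k) + Tr(A₃A₀A₁A₂A₀^k). -/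
open Matrix

/-- Every power of a 2×2 matrix is a linear combination of the matrix and the identity. -/
theorem Matrix.exists_pow_eq_smul_add_smul_one {R : Type*} [CommRing R]
    (A : Matrix (Fin 2) (Fin 2) R) (k : ℕ) :
    ∃ a b : R, A ^ k = a • A + b • (1 : Matrix (Fin 2) (Fin 2) R) := by
  induction k with
  | zero => exact ⟨0, 1, by simp⟩
  | succ k ih =>
    obtain ⟨a, b, h⟩ := ih
    refine ⟨a * A.trace + b, -(a * A.det), ?_⟩
    rw [pow_succ, h]
    ext i j
    fin_cases i <;> fin_cases j <;>
      simp [Matrix.mul_apply, Fin.sum_univ_two, Matrix.trace_fin_two, Matrix.det_fin_two] <;> ring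

/-- A trace identity for 2×2 complex matrices, valid for all powers `k`. -/
theorem trace_identity_pow (A₀ A₁ A₂ A₃ : Matrix (Fin 2) (Fin 2) ℂ) (k : ℕ) :
    (A₁ * A₂ * A₀ * A₃ * A₀ ^ k).trace + (A₂ * A₃ * A₀ * A₁ * A₀ ^ k).trace
        + (A₃ * A₁ * A₀ * A₂ * A₀ ^ k).trace
      = (A₁ * A₀ * A₂ * A₃ * A₀ ^ k).trace + (A₂ * A₀ * A₃ * A₁ * A₀ ^ k).trace
        + (A₃ * A₀ * A₁ * A₂ * A₀ ^ k).trace := by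
  obtain ⟨a, b, h⟩ := A₀.exists_pow_eq_smul_add_smul_one k
  rw [h]
  simp only [mul_add, Matrix.mul_smul, mul_one, trace_add, trace_smul, smul_eq_mul]
  simp only [Matrix.trace_fin_two, Matrix.mul_apply, Fin.sum_univ_two]
  ring
end

section
/- For any 2×2 complex matrices A₀ and A₁, the following identity holds: Tr(A₁³A₀²A₁A₀²) + Tr(A₁²A₀A₁A₀A₁A₀²) + Tr(A₁²A₀³A₁²A₀) = Tr(A₁²A₀A₁A₀²A₁A₀) + Tr(A₁²A₀²A₁²A₀²) + Tr(A₁³A₀³A₁A₀). (This is the unique linear relation on uMPS(2,2,8) that does not follow from dihedral symmetry.) -/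
open Matrix

/-- The unique linear relation on uMPS(2,2,8) not following from dihedral symmetry. -/
theorem uMPS228_linear_relation (A₀ A₁ : Matrix (Fin 2) (Fin 2) ℂ) :
    (A₁ ^ 3 * A₀ ^ 2 * A₁ * A₀ ^ 2).trace
        + (A₁ ^ 2 * A₀ * A₁ * A₀ * A₁ * A₀ ^ 2).trace
        + (A₁ ^ 2 * A₀ ^ 3 * A₁ ^ 2 * A₀).trace
      = (A₁ ^ 2 * A₀ * A₁ * A₀ ^ 2 * A₁ * A₀).trace
        + (A₁ ^ 2 * A₀ ^ 2 * A₁ ^ 2 * A₀ ^ 2).trace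
        + (A₁ ^ 3 * A₀ ^ 3 * A₁ * A₀).trace := by
  obtain ⟨a, b, c, d, rfl⟩ : ∃ a b c d, A₀ = !![a, b; c, d] :=
    ⟨_, _, _, _, eta_fin_two A₀⟩
  obtain ⟨e, f, g, h, rfl⟩ : ∃ e f g h, A₁ = !![e, f; g, h] :=
    ⟨_, _, _, _, eta_fin_two A₁⟩
  simp only [pow_succ, pow_zero, one_mul, mul_fin_two, trace_fin_two_of]
  ring
end

section
/- Let m ≥ 1, let A₀, A₁, …, A_m, B be m×m complex matrices, and let ℓ ∈ ℕ. For t ∈ {0,…,m}, let τ_t : {0,…,m} → {0,…,m} be the cyclic shift i ↦ i + t (mod m+1), whose sign as a permutation is (−1)^{t·m}. Then Σ_{σ ∈ S_m} Σ_{t=0}^{m} sgn(σ)·(−1)^{t·m} · Tr(A_{τ_t(0)}·B^{σ(0)}·A_{τ_t(1)}·B^{σ(1)} ⋯ A_{τ_t(m−1)}·B^{σ(m−1)}·A_{τ_t(m)}·B^{ℓ}) = 0, where S_m is the symmetric group of permutations of {0,1,…,m−1} and sgn(σ) is the sign of σ. -/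
open Matrix

open Equiv in
/-- The permutation of `Fin (m + 1)` extending a permutation of `Fin m` and fixing the last element. -/
def extendLast {m : ℕ} (σ : Perm (Fin m)) : Perm (Fin (m + 1)) :=
  finSuccEquivLast.symm.permCongr (optionCongr σ)

@[simp]
lemma extendLast_last {m : ℕ} (σ : Equiv.Perm (Fin m)) :
    extendLast σ (Fin.last m) = Fin.last m := by
  simp [extendLast, Equiv.permCongr_apply]

@[simp]
lemma extendLast_castSucc {m : ℕ} (σ : Equiv.Perm (Fin m)) (i : Fin m) :
    extendLast σ i.castSucc = (σ i).castSucc := by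
  simp [extendLast, Equiv.permCongr_apply]

@[simp]
lemma sign_extendLast {m : ℕ} (σ : Equiv.Perm (Fin m)) :
    Equiv.Perm.sign (extendLast σ) = Equiv.Perm.sign σ := by
  simp [extendLast]

lemma finRotate_pow_apply {m : ℕ} (k : ℕ) (i : Fin (m + 1)) :
    (finRotate (m + 1) ^ k) i = i + Fin.ofNat (m + 1) k := by
  induction k with
  | zero => simp
  | succ k ih =>
    rw [pow_succ', Equiv.Perm.mul_apply, ih, finRotate_apply]
    ext
    simp [Fin.val_add, add_assoc]

lemma finRotate_pow_val_apply {m : ℕ} (t i : Fin (m + 1)) :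
    (finRotate (m + 1) ^ (t : ℕ)) i = i + t := by
  rw [finRotate_pow_apply, Fin.ofNat_val_eq_self]

/-- Every permutation of `Fin (m + 1)` is uniquely a permutation fixing the last element
precomposed with a cyclic shift. -/
lemma bijective_extendLast_mul_finRotate_pow_inv (m : ℕ) :
    Function.Bijective fun p : Equiv.Perm (Fin m) × Fin (m + 1) =>
      extendLast p.1 * (finRotate (m + 1) ^ (p.2 : ℕ))⁻¹ := by
  rw [Fintype.bijective_iff_injective_and_card]
  constructor
  · rintro ⟨σ, t⟩ ⟨σ', t'⟩ h
    replace h : extendLast σ * (finRotate (m + 1) ^ (t : ℕ))⁻¹ =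
      extendLast σ' * (finRotate (m + 1) ^ (t' : ℕ))⁻¹ := h
    have key (σ : Equiv.Perm (Fin m)) (t : Fin (m + 1)) :
        (extendLast σ * (finRotate (m + 1) ^ (t : ℕ))⁻¹)⁻¹ (Fin.last m) = Fin.last m + t := by
      rw [Equiv.Perm.inv_eq_iff_eq, ← finRotate_pow_val_apply]
      simp
    obtain rfl : t = t' := by
      have := key σ t
      rw [h, key] at this
      exact (add_left_cancel this).symm
    rw [mul_left_inj] at h
    congr 1
    ext i : 1
    have := congr($h i.castSucc)
    simpa using this
  · simp [Fintype.card_perm, Nat.factorial_succ, mul_comm]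

namespace Matrix

variable {n R : Type*} [Fintype n] [DecidableEq n] [CommRing R]

lemma trace_prod_ofFn_comp_finRotate_pow {m : ℕ} (f : Fin (m + 1) → Matrix n n R) (k : ℕ) :
    (List.ofFn fun i => f ((finRotate (m + 1) ^ k) i)).prod.trace = (List.ofFn f).prod.trace := by
  induction k with
  | zero => simp
  | succ k ih =>
    rw [← ih, List.ofFn_succ', List.ofFn_succ, List.concat_eq_append, List.prod_append,
      List.prod_cons, trace_mul_comm]
    simp [pow_succ, Fin.coeSucc_eq_succ]

/-- By Cayley–Hamilton, every power of an `n × n` matrix is a linear combination of its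
powers of exponent less than `n`. -/
lemma pow_mem_span_range_pow {k : ℕ} (hk : Fintype.card n = k) (B : Matrix n n R) (ℓ : ℕ) :
    B ^ ℓ ∈ Submodule.span R (Set.range fun i : Fin k => B ^ (i : ℕ)) := by
  nontriviality R
  rw [pow_eq_aeval_mod_charpoly, Polynomial.aeval_eq_sum_range]
  refine Submodule.sum_mem _ fun i _ => ?_
  by_cases hi : (Polynomial.X ^ ℓ %ₘ B.charpoly).coeff i = 0
  · simp [hi]
  have hlt : i < k := by
    have := (Polynomial.le_degree_of_ne_zero hi).trans_lt
      (Polynomial.degree_modByMonic_lt _ B.charpoly_monic)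
    rw [charpoly_degree_eq_dim, hk] at this
    exact_mod_cast this
  exact Submodule.smul_mem _ _ (Submodule.subset_span ⟨⟨i, hlt⟩, rfl⟩)

/-- The multilinear form `C ↦ Tr (A₀ C₀ A₁ C₁ ⋯ A_{k-1} C_{k-1})`. -/
def traceProdMultilinear {k : ℕ} (A : Fin k → Matrix n n R) :
    MultilinearMap R (fun _ : Fin k => Matrix n n R) R :=
  (traceLinearMap n R R).compMultilinearMap
    ((MultilinearMap.mkPiAlgebraFin R k (Matrix n n R)).compLinearMap
      fun i => LinearMap.mulLeft R (A i))

lemma traceProdMultilinear_apply {k : ℕ} (A C : Fin k → Matrix n n R) :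
    traceProdMultilinear A C = (List.ofFn fun i => A i * C i).prod.trace := by
  simp [traceProdMultilinear]

lemma traceProdMultilinear_comp_perm {m : ℕ} (A C : Fin (m + 1) → Matrix n n R)
    (σ : Equiv.Perm (Fin m)) (t : Fin (m + 1)) :
    traceProdMultilinear A (C ∘ ⇑(extendLast σ * (finRotate (m + 1) ^ (t : ℕ))⁻¹)) =
      ((List.ofFn fun i : Fin m => A (i.castSucc + t) * C (σ i).castSucc).prod
        * A (Fin.last m + t) * C (Fin.last m)).trace := by
  rw [traceProdMultilinear_apply, ← trace_prod_ofFn_comp_finRotate_pow _ (t : ℕ), List.ofFn_succ',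
    List.concat_eq_append, List.prod_append]
  simp only [Function.comp_apply, ← Equiv.Perm.mul_apply,
    inv_mul_cancel_right]
  simp [finRotate_pow_val_apply, mul_assoc]

end Matrix

/-- The Cayley–Hamilton trace relation: the signed sum over permutations `σ ∈ S_m` and
cyclic shifts `τ_t` of `{0,…,m}` of `Tr(A_{τ_t(0)} B^{σ(0)} ⋯ A_{τ_t(m-1)} B^{σ(m-1)} A_{τ_t(m)} B^ℓ)`
vanishes. -/
theorem signed_trace_sum_vanishes (m : ℕ) (hm : 1 ≤ m)
    (A : Fin (m + 1) → Matrix (Fin m) (Fin m) ℂ) (B : Matrix (Fin m) (Fin m) ℂ)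
    (ℓ : ℕ) :
    ∑ σ : Equiv.Perm (Fin m), ∑ t : Fin (m + 1),
      ((Equiv.Perm.sign σ : ℤ) : ℂ) * (-1 : ℂ) ^ ((t : ℕ) * m) *
        (((List.ofFn fun i : Fin m => A (i.castSucc + t) * B ^ ((σ i : ℕ))).prod
            * A (Fin.last m + t) * B ^ ℓ).trace) = 0 := by
  set C : Fin (m + 1) → Matrix (Fin m) (Fin m) ℂ :=
    Fin.snoc (fun i : Fin m => B ^ (i : ℕ)) (B ^ ℓ) with hC
  have hdep : ¬ LinearIndependent ℂ C := by
    rw [hC, linearIndependent_finSnoc, not_and_not_right]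
    intro _
    exact pow_mem_span_range_pow (Fintype.card_fin m) B ℓ
  have h := (traceProdMultilinear A).alternatization.map_linearDependent C hdep
  rw [MultilinearMap.alternatization_apply,
    ← (bijective_extendLast_mul_finRotate_pow_inv m).sum_comp, Fintype.sum_prod_type] at h
  rw [← h]
  refine Finset.sum_congr rfl fun σ _ => Finset.sum_congr rfl fun t _ => ?_
  have hA := traceProdMultilinear_comp_perm A C σ t
  simp only [hC, Fin.snoc_castSucc, Fin.snoc_last] at hA
  rw [← hA, MultilinearMap.domDomCongr_apply]
  simp [Units.smul_def, Function.comp_def, hC, ← pow_mul, mul_comm m]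
end

section
/- Let m ≥ 1, n ≥ 3, and d ≥ (m+1)(m+2)/2. Then there exists a nonzero family of complex coefficients c : {0,…,n−1}^d → ℂ which is invariant under cyclic shifts of the index word (i.e., c(i₁,…,i_d) = c(i₂,…,i_d,i₁) for all words), such that for every n-tuple (A₀,…,A_{n−1}) of m×m complex matrices, Σ_{(i₁,…,i_d) ∈ {0,…,n−1}^d} c(i₁,…,i_d)·Tr(A_{i₁}⋯A_{i_d}) = 0. (Hence uMPS(m,n,d) is contained in a proper linear subspace of the space of cyclically invariant tensors.) -/
open Matrix

/-- The powers `1, X, …, X ^ m` of an `m × m` matrix are linearly dependent. -/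
theorem Matrix.not_linearIndependent_pow {R : Type*} [CommRing R] [Nontrivial R] {m : ℕ}
    (X : Matrix (Fin m) (Fin m) R) :
    ¬ LinearIndependent R (fun i : Fin (m + 1) => X ^ (i : ℕ)) := by
  intro h
  have hdeg : X.charpoly.natDegree = m := by simp [Matrix.charpoly_natDegree_eq_dim]
  have hsum : ∑ i : Fin (m + 1), X.charpoly.coeff i • X ^ (i : ℕ) = 0 := by
    have := X.aeval_self_charpoly
    rwa [Polynomial.aeval_eq_sum_range, hdeg,
      Finset.sum_range (fun i => X.charpoly.coeff i • X ^ i)] at this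
  have hlast := Fintype.linearIndependent_iff.mp h _ hsum (Fin.last m)
  have hmonic := X.charpoly_monic.coeff_natDegree
  rw [hdeg] at hmonic
  simp [hmonic] at hlast

/-- Alternating the powers `1, X, …, X ^ m` of an `m × m` matrix in a product with fixed
interspersed factors gives zero. -/
theorem Matrix.sum_sign_smul_prod_mul_pow {R : Type*} [Field R] {m : ℕ}
    (X : Matrix (Fin m) (Fin m) R) (B : Fin (m + 1) → Matrix (Fin m) (Fin m) R) :
    ∑ σ : Equiv.Perm (Fin (m + 1)), Equiv.Perm.sign σ •
      (List.ofFn fun j => B j * X ^ (σ j : ℕ)).prod = 0 := by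
  have h := (MultilinearMap.alternatization
    ((MultilinearMap.mkPiAlgebraFin R (m + 1) (Matrix (Fin m) (Fin m) R)).compLinearMap
      fun j => LinearMap.mulLeft R (B j))).map_linearDependent _ X.not_linearIndependent_pow
  simpa [MultilinearMap.alternatization_apply] using h

theorem List.ofFn_comp_finRotate {α : Type*} {d : ℕ} (w : Fin (d + 1) → α) :
    List.ofFn (w ∘ finRotate (d + 1)) = List.ofFn (fun i : Fin d => w i.succ) ++ [w 0] := by
  rw [List.ofFn_succ']
  simp

theorem Matrix.trace_prod_ofFn_comp_finRotate {R ι : Type*} [CommRing R] [Fintype ι]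
    [DecidableEq ι] {d : ℕ} (M : Fin d → Matrix ι ι R) :
    (List.ofFn (M ∘ finRotate d)).prod.trace = (List.ofFn M).prod.trace := by
  cases d with
  | zero => simp
  | succ d =>
    rw [List.ofFn_comp_finRotate, List.prod_append, Matrix.trace_mul_comm, List.ofFn_succ]
    simp

theorem Matrix.trace_prod_ofFn_comp_of_mem_zpowers {R ι : Type*} [CommRing R] [Fintype ι]
    [DecidableEq ι] {d : ℕ} {g : Equiv.Perm (Fin d)} (hg : g ∈ Subgroup.zpowers (finRotate d))
    (M : Fin d → Matrix ι ι R) :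
    (List.ofFn (M ∘ g)).prod.trace = (List.ofFn M).prod.trace := by
  obtain ⟨k, rfl⟩ := mem_powers_iff_mem_zpowers.mpr hg
  induction k generalizing M with
  | zero => simp
  | succ k ih =>
    have h := ih (M ∘ finRotate d) ((mem_powers_iff_mem_zpowers).mp ⟨k, rfl⟩)
    rw [Matrix.trace_prod_ofFn_comp_finRotate] at h
    simpa [pow_succ', Equiv.Perm.coe_mul, Function.comp_assoc] using h

theorem eq_one_of_mem_zpowers_finRotate {d : ℕ} {g : Equiv.Perm (Fin (d + 1))}
    (hg : g ∈ Subgroup.zpowers (finRotate (d + 1))) (h0 : g 0 = 0) : g = 1 := by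
  have hcomm : Commute g (finRotate (d + 1)) := by
    obtain ⟨k, rfl⟩ := hg
    exact (Commute.refl _).zpow_left k
  have hstep (i : Fin (d + 1)) : g (i + 1) = g i + 1 := by
    simpa using DFunLike.congr_fun hcomm.eq i
  ext1 i
  induction i using Fin.induction with
  | zero => simpa using h0
  | succ i ih =>
    rw [← Fin.coeSucc_eq_succ, hstep, ih]
    rfl

theorem List.replicate_append_cons_inj {α : Type*} {x y : α} (hxy : x ≠ y) {p q : ℕ}
    {l l' : List α} (h : List.replicate p x ++ y :: l = List.replicate q x ++ y :: l') :
    p = q ∧ l = l' := by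
  induction p generalizing q with
  | zero =>
    cases q with
    | zero => simpa using h
    | succ q => simp [List.replicate_succ, hxy.symm] at h
  | succ p ih =>
    cases q with
    | zero => simp [List.replicate_succ, hxy] at h
    | succ q =>
      have := @ih q (by simpa [List.replicate_succ] using h)
      simpa using this

/-- A word in two letters is determined by the lengths of its runs of `x` separated by `y`. -/
theorem List.replicate_append_flatten_inj {α : Type*} {x y : α} (hxy : x ≠ y) {k p q : ℕ}
    {f g : Fin k → ℕ}
    (h : List.replicate p x ++ (List.ofFn fun j => y :: List.replicate (f j) x).flatten =
      List.replicate q x ++ (List.ofFn fun j => y :: List.replicate (g j) x).flatten) :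
    p = q ∧ f = g := by
  induction k generalizing p q with
  | zero => exact ⟨by simpa using congrArg List.length h, Subsingleton.elim _ _⟩
  | succ k ih =>
    simp only [List.ofFn_succ, List.flatten_cons, List.cons_append] at h
    obtain ⟨hpq, h⟩ := List.replicate_append_cons_inj hxy h
    obtain ⟨h0, hs⟩ := ih h
    refine ⟨hpq, funext fun j => ?_⟩
    cases j using Fin.cases with
    | zero => exact h0
    | succ j => exact congrFun hs j

/-- The word `z x^e x^(f 0) y x^(f 1) y ⋯ y x^(f m)`. -/
def blockWord {α : Type*} {m : ℕ} (x y z : α) (e : ℕ) (f : Fin (m + 1) → ℕ) : List α :=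
  (List.ofFn fun j =>
    (Fin.cons (z :: List.replicate e x) (fun _ => [y]) : Fin (m + 1) → List α) j ++
      List.replicate (f j) x).flatten

theorem blockWord_eq_cons {α : Type*} {m : ℕ} (x y z : α) (e : ℕ) (f : Fin (m + 1) → ℕ) :
    blockWord x y z e f = z :: (List.replicate (e + f 0) x ++
      (List.ofFn fun j : Fin m => y :: List.replicate (f j.succ) x).flatten) := by
  simp [blockWord, List.ofFn_succ]

theorem blockWord_injective {α : Type*} {m : ℕ} {x y : α} (hxy : x ≠ y) (z : α) (e : ℕ) :
    Function.Injective (blockWord (m := m) x y z e) := by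
  intro f g h
  rw [blockWord_eq_cons, blockWord_eq_cons, List.cons.injEq] at h
  obtain ⟨h0, hs⟩ := List.replicate_append_flatten_inj hxy h.2
  funext j
  cases j using Fin.cases with
  | zero => exact Nat.add_left_cancel h0
  | succ j => exact congrFun hs j

theorem length_blockWord {α : Type*} {m : ℕ} (x y z : α) (e : ℕ)
    (σ : Equiv.Perm (Fin (m + 1))) :
    (blockWord x y z e fun j => (σ j : ℕ)).length = (m + 1) * (m + 2) / 2 + e := by
  have hsum : ∑ j, (σ j : ℕ) = (m + 1) * m / 2 := by
    rw [Equiv.sum_comp σ (fun j => (j : ℕ)), Fin.sum_univ_eq_sum_range (fun j => j),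
      Finset.sum_range_id, Nat.add_sub_cancel]
  have hsplit : (m + 1) * (m + 2) / 2 = (m + 1) * m / 2 + (m + 1) := by
    rw [mul_add, Nat.add_mul_div_right _ _ two_pos]
  rw [Fin.sum_univ_succ] at hsum
  rw [blockWord_eq_cons]
  simp [List.length_flatten, List.map_ofFn, List.sum_ofFn, Finset.sum_add_distrib,
    Function.comp_def]
  omega

theorem prod_map_blockWord {α M : Type*} [Monoid M] {m : ℕ} (x y z : α) (e : ℕ)
    (f : Fin (m + 1) → ℕ) (A : α → M) :
    ((blockWord x y z e f).map A).prod = (List.ofFn fun j =>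
      (((Fin.cons (z :: List.replicate e x) (fun _ => [y]) : Fin (m + 1) → List α) j).map A).prod *
        A x ^ f j).prod := by
  rw [blockWord, List.map_flatten, List.prod_flatten, List.map_ofFn, List.map_ofFn]
  congr 2
  funext j
  simp only [Function.comp_apply, List.map_append, List.prod_append, List.map_replicate,
    List.prod_replicate]

theorem List.exists_ofFn_eq {α : Type*} {d : ℕ} (l : List α) (h : l.length = d) :
    ∃ w : Fin d → α, List.ofFn w = l := by
  subst h
  exact ⟨l.get, List.ofFn_get l⟩

/-- Rotations of block words coincide only if the words do. -/
theorem eq_of_comp_mem_zpowers_finRotate {α : Type*} {m d : ℕ} {x y z : α} (hxy : x ≠ y)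
    (hxz : x ≠ z) (hyz : y ≠ z) {e : ℕ} {f f' : Fin (m + 1) → ℕ} {w w' : Fin d → α}
    (hw : List.ofFn w = blockWord x y z e f) (hw' : List.ofFn w' = blockWord x y z e f')
    {g : Equiv.Perm (Fin d)} (hg : g ∈ Subgroup.zpowers (finRotate d)) (h : w ∘ g = w') :
    f = f' := by
  cases d with
  | zero => simp [blockWord_eq_cons] at hw
  | succ d =>
    have hw1 := hw
    have hw1' := hw'
    rw [blockWord_eq_cons, List.ofFn_succ, List.cons.injEq] at hw1 hw1'
    have hne (i : Fin d) : w i.succ ≠ z := by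
      have hmem : w i.succ ∈ List.ofFn fun i : Fin d => w i.succ := by simp
      rw [hw1.2] at hmem
      intro hz
      rw [hz] at hmem
      simp [List.mem_replicate, List.mem_ofFn, hxz.symm, hyz.symm] at hmem
    have hg0 : g 0 = 0 := by
      have h0 : w (g 0) = z := (congrFun h 0).trans hw1'.1
      by_contra hne0
      obtain ⟨i, hi⟩ := Fin.exists_succ_eq.mpr hne0
      exact hne i (hi ▸ h0)
    rw [eq_one_of_mem_zpowers_finRotate hg hg0] at h
    have hww : w = w' := by simpa using h
    subst hww
    exact blockWord_injective hxy z e (hw.symm.trans hw')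

/-- For `n ≥ 3` and `d ≥ (m+1)(m+2)/2`, the variety uMPS(m,n,d) satisfies a nontrivial
linear relation which is invariant under cyclic shifts; hence it is contained in a
proper linear subspace of the space of cyclically invariant tensors. -/
theorem uMPS_proper_subspace (m n d : ℕ) (hm : 1 ≤ m) (hn : 3 ≤ n)
    (hd : (m + 1) * (m + 2) / 2 ≤ d) :
    ∃ c : (Fin d → Fin n) → ℂ, c ≠ 0 ∧
      (∀ w : Fin d → Fin n, c w = c (w ∘ finRotate d)) ∧
      ∀ A : Fin n → Matrix (Fin m) (Fin m) ℂ,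
        ∑ w : Fin d → Fin n, c w * ((List.ofFn fun ℓ => A (w ℓ)).prod).trace = 0 := by
  classical
  obtain ⟨e, rfl⟩ := Nat.exists_eq_add_of_le hd
  set d := (m + 1) * (m + 2) / 2 + e
  let x : Fin n := ⟨0, by omega⟩
  let y : Fin n := ⟨1, by omega⟩
  let z : Fin n := ⟨2, by omega⟩
  have hxy : x ≠ y := by simp [x, y]
  have hxz : x ≠ z := by simp [x, z]
  have hyz : y ≠ z := by simp [y, z]
  choose u hu using fun σ : Equiv.Perm (Fin (m + 1)) =>
    List.exists_ofFn_eq _ (length_blockWord x y z e σ)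
  let c : (Fin d → Fin n) → ℂ := fun w => ∑ σ : Equiv.Perm (Fin (m + 1)),
    ∑ g : Subgroup.zpowers (finRotate d),
      if w = u σ ∘ (g : Equiv.Perm (Fin d)) then ((Equiv.Perm.sign σ : ℤ) : ℂ) else 0
  refine ⟨c, fun hc => ?_, fun w => ?_, fun A => ?_⟩
  · have hc1 : c (u 1) = 0 := congrFun hc _
    have hσ : c (u 1) = ∑ g : Subgroup.zpowers (finRotate d),
        if u 1 = u 1 ∘ (g : Equiv.Perm (Fin d)) then (1 : ℂ) else 0 := by
      refine (Finset.sum_eq_single 1 (fun σ _ hσ => ?_) (by simp)).trans (by simp)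
      refine Finset.sum_eq_zero fun g _ => if_neg fun h => hσ ?_
      have hf := eq_of_comp_mem_zpowers_finRotate hxy hxz hyz (hu σ) (hu 1) g.2 h.symm
      ext j
      exact congrFun hf j
    rw [hσ, Finset.sum_boole, Nat.cast_eq_zero, Finset.card_eq_zero] at hc1
    exact Finset.notMem_empty (1 : Subgroup.zpowers (finRotate d)) (hc1 ▸ by simp)
  · refine Finset.sum_congr rfl fun σ _ => ?_
    let r : Subgroup.zpowers (finRotate d) := ⟨finRotate d, Subgroup.mem_zpowers _⟩
    symm
    rw [← Equiv.sum_comp (Equiv.mulRight r)]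
    refine Finset.sum_congr rfl fun g _ => ?_
    congr 1
    simp only [Equiv.coe_mulRight, Subgroup.coe_mul, Equiv.Perm.coe_mul, r,
      ← Function.comp_assoc, (finRotate d).surjective.injective_comp_right.eq_iff]
  · have htr (σ : Equiv.Perm (Fin (m + 1))) (g : Subgroup.zpowers (finRotate d)) :
        (List.ofFn fun ℓ => A ((u σ ∘ (g : Equiv.Perm (Fin d))) ℓ)).prod.trace =
          ((blockWord x y z e fun j => (σ j : ℕ)).map A).prod.trace := by
      rw [← hu σ, List.map_ofFn]
      exact Matrix.trace_prod_ofFn_comp_of_mem_zpowers g.2 (A ∘ u σ)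
    have key := congrArg Matrix.trace (Matrix.sum_sign_smul_prod_mul_pow (A x) fun j =>
      (((Fin.cons (z :: List.replicate e x) (fun _ => [y]) :
        Fin (m + 1) → List (Fin n)) j).map A).prod)
    simp only [← prod_map_blockWord x y z e _ A, Matrix.trace_sum, Matrix.trace_zero] at key
    simp only [c, Finset.sum_mul]
    rw [Finset.sum_comm]
    simp_rw [Finset.sum_comm (s := (Finset.univ : Finset (Fin d → Fin n))), ite_mul, zero_mul,
      Finset.sum_ite_eq', Finset.mem_univ, if_true, htr, Finset.sum_const]
    rw [← Finset.smul_sum]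
    convert smul_zero _
    rw [← key]
    refine Finset.sum_congr rfl fun σ _ => ?_
    rw [Units.smul_def, Matrix.trace_smul, zsmul_eq_mul]
end

section
/- Let m ≥ 1 and d = (m+2)(m+3)/2. Then there exists a nonzero family of complex coefficients c : {0,1}^d → ℂ which is invariant under cyclic shifts of the index word (i.e., c(i₁,…,i_d) = c(i₂,…,i_d,i₁) for all words), such that for every pair (A₀, A₁) of m×m complex matrices, Σ_{(i₁,…,i_d) ∈ {0,1}^d} c(i₁,…,i_d)·Tr(A_{i₁}⋯A_{i_d}) = 0. (Hence uMPS(m,2,d) satisfies a nontrivial linear relation.) -/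
open Matrix

/-- The trace of a product of matrices read along a word does not change under a cyclic shift. -/
theorem trace_ofFn_prod_comp_finRotate {n R : Type*} [Fintype n] [DecidableEq n] [CommRing R]
    {d : ℕ} (A : Fin 2 → Matrix n n R) (w : Fin d → Fin 2) :
    ((List.ofFn fun l => A ((w ∘ finRotate d) l)).prod).trace =
      ((List.ofFn fun l => A (w l)).prod).trace := by
  cases d with
  | zero => simp
  | succ d =>
    rw [List.ofFn_succ', List.ofFn_succ, List.concat_eq_append, List.prod_append,
      List.prod_singleton, List.prod_cons, Matrix.trace_mul_comm]
    simp

theorem trace_ofFn_prod_comp_of_mem_zpowers {n R : Type*} [Fintype n] [DecidableEq n] [CommRing R]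
    {d : ℕ} (A : Fin 2 → Matrix n n R) {g : Equiv.Perm (Fin d)}
    (hg : g ∈ Subgroup.zpowers (finRotate d)) (w : Fin d → Fin 2) :
    ((List.ofFn fun l => A ((w ∘ g) l)).prod).trace =
      ((List.ofFn fun l => A (w l)).prod).trace := by
  rw [Subgroup.zpowers_eq_closure] at hg
  induction hg using Subgroup.closure_induction generalizing w with
  | mem x hx => rw [Set.mem_singleton_iff.1 hx]; exact trace_ofFn_prod_comp_finRotate A w
  | one => rfl
  | mul x y _ _ hx hy => exact (hy (w ∘ x)).trans (hx w)
  | inv x _ hx =>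
    rw [← hx]
    congr 4
    ext l
    simp

/-- The word `0^(a 0) 1 0^(a 1) 1 ⋯ 0^(a (k-1)) 1`. -/
def gapWord {k : ℕ} (a : Fin k → ℕ) : List (Fin 2) :=
  (List.ofFn fun i => List.replicate (a i) 0 ++ [1]).flatten

theorem length_gapWord {k : ℕ} (a : Fin k → ℕ) : (gapWord a).length = ∑ i, (a i + 1) := by
  simp [gapWord, List.length_flatten, List.map_ofFn, List.sum_ofFn]

theorem prod_map_gapWord {M : Type*} [Monoid M] {k : ℕ} (A : Fin 2 → M) (a : Fin k → ℕ) :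
    ((gapWord a).map A).prod = (List.ofFn fun i => A 0 ^ a i * A 1).prod := by
  simp [gapWord, List.map_flatten, List.prod_flatten, List.map_ofFn, Function.comp_def]

/-- The gap sequence `σ 0, …, σ m, m + 1`. -/
def gaps {m : ℕ} (σ : Equiv.Perm (Fin (m + 1))) : Fin (m + 2) → ℕ :=
  Fin.snoc (fun i => (σ i : ℕ)) (m + 1)

theorem length_gapWord_gaps {m : ℕ} (σ : Equiv.Perm (Fin (m + 1))) :
    (gapWord (gaps σ)).length = (m + 2) * (m + 3) / 2 := by
  have h : ∑ i : Fin (m + 1), ((σ i : ℕ) + 1) = ∑ i : Fin (m + 1), ((i : ℕ) + 1) :=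
    Equiv.sum_comp σ fun i => (i : ℕ) + 1
  rw [length_gapWord, Fin.sum_univ_castSucc]
  simp only [gaps, Fin.snoc_castSucc, Fin.snoc_last]
  rw [h, Fin.sum_univ_eq_sum_range (fun i => i + 1) (m + 1),
    ← Finset.sum_range_succ (fun i => i + 1) (m + 1)]
  have h2 := Finset.sum_range_succ' (fun i => i) (m + 2)
  rw [Finset.sum_range_id] at h2
  simp only [add_zero] at h2
  rw [← h2, mul_comm]
  rfl

theorem exists_ofFn_eq_gapWord_gaps {m d : ℕ} (hd : d = (m + 2) * (m + 3) / 2)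
    (σ : Equiv.Perm (Fin (m + 1))) : ∃ w : Fin d → Fin 2, List.ofFn w = gapWord (gaps σ) := by
  rw [← length_gapWord_gaps σ] at hd
  subst hd
  exact ⟨_, List.ofFn_get _⟩

/-- The alternating sum of `X ^ σ 0 * Y * ⋯ * X ^ σ m * Y` vanishes on `m × m` matrices, since
`1, X, …, X ^ m` are linearly dependent. -/
theorem sum_sign_smul_prod_pow_mul_eq_zero {K : Type*} [Field K] {m : ℕ}
    (X Y : Matrix (Fin m) (Fin m) K) :
    ∑ σ : Equiv.Perm (Fin (m + 1)),
      Equiv.Perm.sign σ • (List.ofFn fun i => X ^ (σ i : ℕ) * Y).prod = 0 := by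
  have hdep : ¬ LinearIndependent K fun i : Fin (m + 1) => X ^ (i : ℕ) := by
    intro h
    rw [Fintype.linearIndependent_iff] at h
    have hCH := X.aeval_self_charpoly
    have hdeg : X.charpoly.natDegree = m := by simp
    rw [Polynomial.aeval_eq_sum_range, hdeg, ← Fin.sum_univ_eq_sum_range
      (fun i => X.charpoly.coeff i • X ^ i) (m + 1)] at hCH
    have h1 := h (fun i => X.charpoly.coeff i) hCH (Fin.last m)
    have h2 := X.charpoly_monic.coeff_natDegree
    rw [hdeg] at h2
    simp only [Fin.val_last] at h1
    exact one_ne_zero (h2.symm.trans h1)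
  have h := (MultilinearMap.alternatization
    ((MultilinearMap.mkPiAlgebraFin K (m + 1) (Matrix (Fin m) (Fin m) K)).compLinearMap
      fun _ => LinearMap.mulRight K Y)).map_linearDependent _ hdep
  rw [MultilinearMap.alternatization_apply] at h
  simpa using h

theorem sum_sign_mul_trace_eq_zero {K : Type*} [Field K] {m : ℕ}
    (X Y : Matrix (Fin m) (Fin m) K) :
    ∑ σ : Equiv.Perm (Fin (m + 1)),
      ((Equiv.Perm.sign σ : ℤ) : K) * (List.ofFn fun i => X ^ gaps σ i * Y).prod.trace = 0 := by
  have h := congrArg (fun M => (M * (X ^ (m + 1) * Y)).trace)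
    (sum_sign_smul_prod_pow_mul_eq_zero X Y)
  simp only [Finset.sum_mul, Matrix.trace_sum, zero_mul, Matrix.trace_zero] at h
  rw [← h]
  refine Finset.sum_congr rfl fun σ _ => ?_
  rw [List.ofFn_succ', List.concat_eq_append, List.prod_append, List.prod_singleton]
  simp only [gaps, Fin.snoc_castSucc, Fin.snoc_last]
  rw [Units.smul_def, smul_mul_assoc, Matrix.trace_smul, zsmul_eq_mul]

/-- The matrix of the cyclic shift. -/
def shiftMatrix (n : ℕ) [NeZero n] (R : Type*) [Zero R] [One R] : Matrix (Fin n) (Fin n) R :=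
  Matrix.of fun i j => if j = i + 1 then 1 else 0

theorem prod_diagonal_pow_mul_shiftMatrix_apply {R : Type*} [CommRing R] {n : ℕ} [NeZero n]
    (x : Fin n → R) {k : ℕ} (a : Fin k → ℕ) (i j : Fin n) :
    (List.ofFn fun l => diagonal x ^ a l * shiftMatrix n R).prod i j =
      (∏ l : Fin k, x (i + Fin.ofNat n l) ^ a l) * if j = i + Fin.ofNat n k then 1 else 0 := by
  induction k generalizing i with
  | zero => simp [Matrix.one_apply, eq_comm]
  | succ k ih =>
    have hk (l : ℕ) : i + 1 + Fin.ofNat n l = i + Fin.ofNat n (l + 1) := by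
      have : Fin.ofNat n (l + 1) = Fin.ofNat n l + 1 := by
        simp [Fin.ext_iff, Fin.val_add]
      rw [this, add_assoc, add_comm 1]
    have hshift (P : Matrix (Fin n) (Fin n) R) : (shiftMatrix n R * P) i j = P (i + 1) j := by
      simp [shiftMatrix, Matrix.mul_apply]
    rw [List.ofFn_succ, List.prod_cons, mul_assoc, Matrix.diagonal_pow, Matrix.diagonal_mul,
      hshift, ih, hk, Fin.prod_univ_succ, ← mul_assoc]
    simp only [hk, Fin.val_succ]
    simp

theorem trace_prod_diagonal_pow_mul_shiftMatrix {R : Type*} [CommRing R] {n : ℕ} [NeZero n]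
    (x : Fin n → R) (a : Fin n → ℕ) :
    (List.ofFn fun l => diagonal x ^ a l * shiftMatrix n R).prod.trace =
      ∑ s, ∏ j, x j ^ a (j - s) := by
  refine Finset.sum_congr rfl fun s _ => ?_
  rw [Matrix.diag_apply, prod_diagonal_pow_mul_shiftMatrix_apply]
  have h0 : Fin.ofNat n n = 0 := by simp
  rw [h0, add_zero, if_pos rfl, mul_one]
  refine Fintype.prod_equiv (Equiv.addLeft s) _ _ fun l => ?_
  simp

theorem gaps_sub_eq_iff {m : ℕ} (σ : Equiv.Perm (Fin (m + 1))) (s : Fin (m + 2)) :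
    (∀ j : Fin (m + 2), gaps σ (j - s) = j) ↔ s = 0 ∧ σ = 1 := by
  constructor
  · intro h
    have hs : s = 0 := by
      have hl := h (Fin.last (m + 1))
      generalize ht : Fin.last (m + 1) - s = t at hl
      induction t using Fin.lastCases with
      | last => simpa using ht
      | cast i =>
        simp only [gaps, Fin.snoc_castSucc, Fin.val_last] at hl
        have := (σ i).isLt
        omega
    subst hs
    refine ⟨rfl, Equiv.ext fun i => Fin.ext ?_⟩
    simpa [gaps] using h i.castSucc
  · rintro ⟨rfl, rfl⟩ j
    induction j using Fin.lastCases with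
    | last => simp [gaps]
    | cast i => simp [gaps]

theorem sum_sign_mul_trace_generic_ne_zero (m : ℕ) :
    ∑ σ : Equiv.Perm (Fin (m + 1)),
      ((Equiv.Perm.sign σ : ℤ) : MvPolynomial (Fin (m + 2)) ℤ) *
        (List.ofFn fun i => diagonal (MvPolynomial.X : Fin (m + 2) → MvPolynomial (Fin (m + 2)) ℤ)
          ^ gaps σ i * shiftMatrix (m + 2) _).prod.trace ≠ 0 := by
  intro h
  have hcoeff := congrArg
    (MvPolynomial.coeff (Finsupp.equivFunOnFinite.symm fun j : Fin (m + 2) => (j : ℕ))) h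
  have hmon (a : Fin (m + 2) → ℕ) :
      ∏ j, (MvPolynomial.X j : MvPolynomial (Fin (m + 2)) ℤ) ^ a j =
        MvPolynomial.monomial (Finsupp.equivFunOnFinite.symm a) 1 := by
    rw [MvPolynomial.monomial_eq, Finsupp.prod_fintype _ _ (by simp)]
    simp
  have hcast (z : ℤ) : (z : MvPolynomial (Fin (m + 2)) ℤ) = MvPolynomial.C z := by simp
  simp only [trace_prod_diagonal_pow_mul_shiftMatrix, hmon, MvPolynomial.coeff_sum, hcast,
    MvPolynomial.coeff_C_mul, MvPolynomial.coeff_monomial, EmbeddingLike.apply_eq_iff_eq,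
    funext_iff, gaps_sub_eq_iff, MvPolynomial.coeff_zero, ite_and, Finset.sum_ite_eq',
    Finset.mem_univ, if_true, mul_ite, mul_one, mul_zero] at hcoeff
  simp at hcoeff

/-- Sum of a function on words over all cyclic shifts. -/
noncomputable def cyclicSum {d : ℕ} (f : (Fin d → Fin 2) → ℤ) (w : Fin d → Fin 2) : ℤ :=
  ∑ g : Subgroup.zpowers (finRotate d), f (w ∘ (g : Equiv.Perm (Fin d)))

theorem cyclicSum_comp_finRotate {d : ℕ} (f : (Fin d → Fin 2) → ℤ) (w : Fin d → Fin 2) :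
    cyclicSum f (w ∘ finRotate d) = cyclicSum f w :=
  Fintype.sum_equiv
    (Equiv.mulLeft (⟨finRotate d, Subgroup.mem_zpowers _⟩ : Subgroup.zpowers (finRotate d)))
    _ _ fun _ => rfl

theorem sum_cyclicSum_mul_trace {n R : Type*} [Fintype n] [DecidableEq n] [CommRing R] {d : ℕ}
    (f : (Fin d → Fin 2) → ℤ) (A : Fin 2 → Matrix n n R) :
    ∑ w, (cyclicSum f w : R) * ((List.ofFn fun l => A (w l)).prod).trace =
      Fintype.card (Subgroup.zpowers (finRotate d)) *
        ∑ w, (f w : R) * ((List.ofFn fun l => A (w l)).prod).trace := by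
  simp only [cyclicSum, Int.cast_sum, Finset.sum_mul]
  rw [Finset.sum_comm, ← nsmul_eq_mul, ← Finset.card_univ, ← Finset.sum_const]
  refine Finset.sum_congr rfl fun g _ => ?_
  refine Fintype.sum_equiv (Equiv.arrowCongr (g : Equiv.Perm (Fin d)).symm (Equiv.refl _)) _ _
    fun w => ?_
  rw [← trace_ofFn_prod_comp_of_mem_zpowers A g.2 w]
  rfl

/-- For `d = (m+2)(m+3)/2`, the variety uMPS(m,2,d) satisfies a nontrivial linear
relation which is invariant under cyclic shifts. -/
theorem uMPS_binary_relation (m d : ℕ) (hm : 1 ≤ m) (hd : d = (m + 2) * (m + 3) / 2) :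
    ∃ c : (Fin d → Fin 2) → ℂ, c ≠ 0 ∧
      (∀ w : Fin d → Fin 2, c w = c (w ∘ finRotate d)) ∧
      ∀ A : Fin 2 → Matrix (Fin m) (Fin m) ℂ,
        ∑ w : Fin d → Fin 2, c w * ((List.ofFn fun ℓ => A (w ℓ)).prod).trace = 0 := by
  choose W hW using exists_ofFn_eq_gapWord_gaps (m := m) hd
  let f : (Fin d → Fin 2) → ℤ := fun w =>
    ∑ σ : Equiv.Perm (Fin (m + 1)), if w = W σ then (Equiv.Perm.sign σ : ℤ) else 0
  have key {N : ℕ} {R : Type} [CommRing R] (A : Fin 2 → Matrix (Fin N) (Fin N) R) :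
      ∑ w, (f w : R) * ((List.ofFn fun l => A (w l)).prod).trace =
        ∑ σ : Equiv.Perm (Fin (m + 1)), ((Equiv.Perm.sign σ : ℤ) : R) *
          (List.ofFn fun i => A 0 ^ gaps σ i * A 1).prod.trace := by
    simp only [f, Int.cast_sum, Finset.sum_mul]
    rw [Finset.sum_comm]
    refine Finset.sum_congr rfl fun σ _ => ?_
    rw [← prod_map_gapWord, ← hW, List.map_ofFn]
    simp [Function.comp_def]
  refine ⟨fun w => cyclicSum f w, fun h => ?_, fun w => ?_, fun A => ?_⟩
  · have h0 (w) : cyclicSum f w = 0 := by simpa using congrFun h w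
    have h1 := sum_cyclicSum_mul_trace f
      ![diagonal (MvPolynomial.X : Fin (m + 2) → MvPolynomial (Fin (m + 2)) ℤ),
        shiftMatrix (m + 2) _]
    simp only [h0, Int.cast_zero, zero_mul, Finset.sum_const_zero] at h1
    rw [key] at h1
    exact mul_ne_zero (Nat.cast_ne_zero.2 Fintype.card_ne_zero)
      (sum_sign_mul_trace_generic_ne_zero m) h1.symm
  · simp only [cyclicSum_comp_finRotate]
  · rw [sum_cyclicSum_mul_trace, key, sum_sign_mul_trace_eq_zero, mul_zero]
end

section
/- For every d ≥ 1, consider, for each word I = (i₁,…,i_d) ∈ {0,1}^d, the function F_I from pairs of 2×2 complex matrices to ℂ given by F_I(A₀,A₁) = Tr(A_{i₁}⋯A_{i_d}). The dimension of the linear span of the family {F_I : I ∈ {0,1}^d} in the vector space of all ℂ-valued functions on pairs of 2×2 matrices is at most (1/192)(d+6)(d+4)²(d+2) if d is even, and at most (1/192)(d+7)(d+5)(d+3)(d+1) if d is odd. (This bounds the dimension of the linear span of uMPS(2,2,d).) -/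
open Matrix

/-- The monomial `(tr A)^a (tr B)^b (det A)^c (det B)^e (tr AB)^g` as a function of `(A, B)`. -/
noncomputable def traceMonomial (a b c e g : ℕ) :
    Matrix (Fin 2) (Fin 2) ℂ × Matrix (Fin 2) (Fin 2) ℂ → ℂ :=
  fun p => p.1.trace ^ a * p.2.trace ^ b * p.1.det ^ c * p.2.det ^ e * (p.1 * p.2).trace ^ g

/-- The span of the trace monomials of total degree `n` in the matrix entries. The degree is an
integer, so that the space is zero in negative degrees. -/
noncomputable def traceInvariants (n : ℤ) :
    Submodule ℂ (Matrix (Fin 2) (Fin 2) ℂ × Matrix (Fin 2) (Fin 2) ℂ → ℂ) :=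
  Submodule.span ℂ {f | ∃ a b c e g : ℕ,
    (a + b + 2 * c + 2 * e + 2 * g : ℤ) = n ∧ f = traceMonomial a b c e g}

theorem traceMonomial_mul (a b c e g a' b' c' e' g' : ℕ) :
    traceMonomial a b c e g * traceMonomial a' b' c' e' g' =
      traceMonomial (a + a') (b + b') (c + c') (e + e') (g + g') := by
  funext p
  simp only [traceMonomial, Pi.mul_apply]
  ring

theorem traceInvariants_mul_mem {m n k : ℤ}
    {f h : Matrix (Fin 2) (Fin 2) ℂ × Matrix (Fin 2) (Fin 2) ℂ → ℂ}
    (hf : f ∈ traceInvariants m) (hh : h ∈ traceInvariants n) (hk : m + n = k) :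
    f * h ∈ traceInvariants k := by
  have hmul := Submodule.mul_mem_mul hf hh
  rw [traceInvariants, traceInvariants, Submodule.span_mul_span] at hmul
  refine Submodule.span_mono ?_ hmul
  rintro _ ⟨_, ⟨a, b, c, e, g, h₁, rfl⟩, _, ⟨a', b', c', e', g', h₂, rfl⟩, rfl⟩
  refine ⟨a + a', b + b', c + c', e + e', g + g', ?_, traceMonomial_mul ..⟩
  push_cast
  linarith

theorem traceMonomial_mem (a b c e g : ℕ) :
    traceMonomial a b c e g ∈ traceInvariants (a + b + 2 * c + 2 * e + 2 * g) :=
  Submodule.subset_span ⟨a, b, c, e, g, rfl, rfl⟩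

theorem one_mem_traceInvariants :
    (fun _ => 1) ∈ traceInvariants 0 := by
  have h := traceMonomial_mem 0 0 0 0 0
  unfold traceMonomial at h
  simpa using h

theorem trace_fst_mem_traceInvariants :
    (fun p => p.1.trace) ∈ traceInvariants 1 := by
  have h := traceMonomial_mem 1 0 0 0 0
  unfold traceMonomial at h
  simpa using h

theorem trace_snd_mem_traceInvariants :
    (fun p => p.2.trace) ∈ traceInvariants 1 := by
  have h := traceMonomial_mem 0 1 0 0 0
  unfold traceMonomial at h
  simpa using h

theorem det_fst_mem_traceInvariants :
    (fun p => p.1.det) ∈ traceInvariants 2 := by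
  have h := traceMonomial_mem 0 0 1 0 0
  unfold traceMonomial at h
  simpa using h

theorem det_snd_mem_traceInvariants :
    (fun p => p.2.det) ∈ traceInvariants 2 := by
  have h := traceMonomial_mem 0 0 0 1 0
  unfold traceMonomial at h
  simpa using h

theorem trace_mul_mem_traceInvariants :
    (fun p => (p.1 * p.2).trace) ∈ traceInvariants 2 := by
  have h := traceMonomial_mem 0 0 0 0 1
  unfold traceMonomial at h
  simpa using h

/-- Every word in two `2 × 2` matrices `A`, `B` is a combination of `1`, `A`, `B`, `AB` whose
coefficients are trace invariants of the complementary degrees. -/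
theorem exists_word_eq_traceInvariants (l : List (Fin 2)) :
    ∃ x ∈ traceInvariants l.length, ∃ y ∈ traceInvariants (l.length - 1),
    ∃ z ∈ traceInvariants (l.length - 1), ∃ w ∈ traceInvariants (l.length - 2),
      ∀ p : Matrix (Fin 2) (Fin 2) ℂ × Matrix (Fin 2) (Fin 2) ℂ,
        (l.map ![p.1, p.2]).prod =
          x p • (1 : Matrix (Fin 2) (Fin 2) ℂ) + y p • p.1 + z p • p.2 + w p • (p.1 * p.2) := by
  induction l with
  | nil =>
    exact ⟨_, one_mem_traceInvariants, 0, zero_mem _, 0, zero_mem _, 0, zero_mem _, by simp⟩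
  | cons i l ih =>
    obtain ⟨x, hx, y, hy, z, hz, w, hw, h⟩ := ih
    have hl : ((i :: l).length : ℤ) = l.length + 1 := by simp
    rw [hl]
    set n : ℤ := (l.length : ℤ)
    have hs := trace_fst_mem_traceInvariants
    have ht := trace_snd_mem_traceInvariants
    have hD := det_fst_mem_traceInvariants
    have hE := det_snd_mem_traceInvariants
    have hT := trace_mul_mem_traceInvariants
    set s : Matrix (Fin 2) (Fin 2) ℂ × Matrix (Fin 2) (Fin 2) ℂ → ℂ := fun p => p.1.trace
      with s_def
    set t : Matrix (Fin 2) (Fin 2) ℂ × Matrix (Fin 2) (Fin 2) ℂ → ℂ := fun p => p.2.trace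
      with t_def
    set D : Matrix (Fin 2) (Fin 2) ℂ × Matrix (Fin 2) (Fin 2) ℂ → ℂ := fun p => p.1.det
      with D_def
    set E : Matrix (Fin 2) (Fin 2) ℂ × Matrix (Fin 2) (Fin 2) ℂ → ℂ := fun p => p.2.det
      with E_def
    set T : Matrix (Fin 2) (Fin 2) ℂ × Matrix (Fin 2) (Fin 2) ℂ → ℂ :=
      fun p => (p.1 * p.2).trace with T_def
    have hst := traceInvariants_mul_mem hs ht (k := 2) (by norm_num)
    have hsE := traceInvariants_mul_mem hs hE (k := 3) (by norm_num)
    fin_cases i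
    · refine ⟨-(y * D), neg_mem (traceInvariants_mul_mem hy hD (by ring)),
        x + y * s, add_mem (by simpa using hx) (traceInvariants_mul_mem hy hs (by ring)),
        -(w * D), neg_mem (traceInvariants_mul_mem hw hD (by ring)),
        z + w * s, add_mem (by convert hz using 2; ring)
          (traceInvariants_mul_mem hw hs (by ring)), fun p => ?_⟩
      rw [List.map_cons, List.prod_cons, h p]
      ext j k
      fin_cases j <;> fin_cases k <;>
        simp [s_def, D_def, Matrix.mul_apply, Fin.sum_univ_two, Matrix.trace_fin_two,
          Matrix.det_fin_two, Matrix.one_apply] <;> ring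
    · refine ⟨y * (T - s * t) - z * E - w * (s * E),
        sub_mem (sub_mem (traceInvariants_mul_mem hy (sub_mem hT hst) (by ring))
          (traceInvariants_mul_mem hz hE (by ring))) (traceInvariants_mul_mem hw hsE (by ring)),
        y * t + w * E, add_mem (traceInvariants_mul_mem hy ht (by ring))
          (traceInvariants_mul_mem hw hE (by ring)),
        x + y * s + z * t + w * T, add_mem (add_mem (add_mem (by simpa using hx)
          (traceInvariants_mul_mem hy hs (by ring))) (traceInvariants_mul_mem hz ht (by ring)))
          (traceInvariants_mul_mem hw hT (by ring)),
        -y, neg_mem (by convert hy using 2; ring), fun p => ?_⟩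
      rw [List.map_cons, List.prod_cons, h p]
      ext j k
      fin_cases j <;> fin_cases k <;>
        simp [s_def, t_def, E_def, T_def, Matrix.mul_apply, Fin.sum_univ_two,
          Matrix.trace_fin_two, Matrix.det_fin_two, Matrix.one_apply] <;> ring

theorem trace_word_mem_traceInvariants (l : List (Fin 2)) :
    (fun p : Matrix (Fin 2) (Fin 2) ℂ × Matrix (Fin 2) (Fin 2) ℂ =>
      (l.map ![p.1, p.2]).prod.trace) ∈ traceInvariants l.length := by
  obtain ⟨x, hx, y, hy, z, hz, w, hw, h⟩ := exists_word_eq_traceInvariants l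
  have key := add_mem (add_mem (add_mem (Submodule.smul_mem _ (2 : ℂ) hx)
    (traceInvariants_mul_mem hy trace_fst_mem_traceInvariants (sub_add_cancel _ 1)))
    (traceInvariants_mul_mem hz trace_snd_mem_traceInvariants (sub_add_cancel _ 1)))
    (traceInvariants_mul_mem hw trace_mul_mem_traceInvariants (sub_add_cancel _ 2))
  convert key using 1
  funext p
  simp [h p, mul_comm]

open Finset.HasAntidiagonal in
/-- The exponents of the trace monomials of degree `d`, sorted by the total exponent of the three
generators of degree two. -/
def traceExponents (d : ℕ) : Finset (Σ _ : ℕ, (Σ _ : ℕ × ℕ, ℕ × ℕ) × (ℕ × ℕ)) :=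
  (Finset.range (d / 2 + 1)).sigma fun k =>
    ((antidiagonal k).sigma fun p => antidiagonal p.1) ×ˢ
      antidiagonal (d - 2 * k)

open scoped Classical in
theorem traceInvariants_le_span_traceExponents (d : ℕ) :
    traceInvariants d ≤ Submodule.span ℂ (((traceExponents d).image fun i =>
      traceMonomial i.2.2.1 i.2.2.2 i.2.1.2.1 i.2.1.2.2 i.2.1.1.2 : Finset _) : Set _) := by
  refine Submodule.span_mono ?_
  rintro _ ⟨a, b, c, e, g, h, rfl⟩
  rw [Finset.coe_image]
  refine ⟨⟨c + e + g, ⟨⟨(c + e, g), (c, e)⟩, (a, b)⟩⟩, ?_, rfl⟩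
  simp only [traceExponents, Finset.coe_sigma, Set.mem_sigma_iff, Finset.mem_coe,
    Finset.mem_range, Finset.mem_product, Finset.mem_sigma,
    Finset.HasAntidiagonal.mem_antidiagonal]
  have hlt : c + e + g < d / 2 + 1 := by omega
  have hab : a + b = d - 2 * (c + e + g) := by omega
  exact ⟨hlt, ⟨trivial, trivial⟩, hab⟩

theorem card_traceExponents (d : ℕ) :
    ((traceExponents d).card : ℚ) =
      ∑ k ∈ Finset.range (d / 2 + 1), ((k + 1) * (k + 2) / 2 : ℚ) * (d - 2 * k + 1) := by
  have hsum (k : ℕ) : (∑ i ∈ Finset.range (k + 1), ((i : ℚ) + 1)) = (k + 1) * (k + 2) / 2 := by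
    induction k with
    | zero => norm_num
    | succ k ih =>
      rw [Finset.sum_range_succ, ih]
      push_cast
      ring
  rw [traceExponents, Finset.card_sigma, Nat.cast_sum]
  refine Finset.sum_congr rfl fun k hk => ?_
  have hk' : 2 * k ≤ d := by
    have := Finset.mem_range.mp hk
    omega
  simp only [Finset.card_product, Finset.card_sigma, Finset.Nat.card_antidiagonal]
  rw [Finset.Nat.sum_antidiagonal_eq_sum_range_succ_mk, ← hsum]
  push_cast [Nat.cast_sub hk']
  rfl

theorem sum_choose_two_mul_sub (x : ℚ) (m : ℕ) :
    ∑ k ∈ Finset.range m, ((k + 1) * (k + 2) / 2 : ℚ) * (x - 2 * k + 1) =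
      m * (m + 1) * (m + 2) * (2 * x + 5 - 3 * m) / 12 := by
  induction m with
  | zero => simp
  | succ m ih =>
    rw [Finset.sum_range_succ, ih]
    push_cast
    ring

/-- Upper bound on the dimension of the linear span of the trace coordinate functions
`F_I(A₀,A₁) = Tr(A_{i₁}⋯A_{i_d})`, i.e. of the linear span of uMPS(2,2,d). -/
theorem dim_span_uMPS22d_le (d : ℕ) (hd : 1 ≤ d) :
    (Module.finrank ℂ (Submodule.span ℂ (Set.range fun I : Fin d → Fin 2 =>
        fun p : Matrix (Fin 2) (Fin 2) ℂ × Matrix (Fin 2) (Fin 2) ℂ =>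
          ((List.ofFn fun ℓ => ![p.1, p.2] (I ℓ)).prod).trace)) : ℚ)
      ≤ if Even d then (1 / 192 : ℚ) * (d + 6) * (d + 4) ^ 2 * (d + 2)
        else (1 / 192 : ℚ) * (d + 7) * (d + 5) * (d + 3) * (d + 1) := by
  have hcard : ((traceExponents d).card : ℚ) =
      if Even d then (1 / 192 : ℚ) * (d + 6) * (d + 4) ^ 2 * (d + 2)
        else (1 / 192 : ℚ) * (d + 7) * (d + 5) * (d + 3) * (d + 1) := by
    rw [card_traceExponents, sum_choose_two_mul_sub]
    split_ifs with h
    · obtain ⟨m, rfl⟩ := h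
      rw [show (m + m) / 2 + 1 = m + 1 by omega]
      push_cast
      ring
    · obtain ⟨m, rfl⟩ := Nat.not_even_iff_odd.mp h
      rw [show (2 * m + 1) / 2 + 1 = m + 1 by omega]
      push_cast
      ring
  classical
  rw [← hcard, Nat.cast_le]
  refine (Submodule.finrank_mono (le_trans (Submodule.span_le.mpr ?_)
    (traceInvariants_le_span_traceExponents d))).trans
    ((finrank_span_finset_le_card _).trans Finset.card_image_le)
  rintro _ ⟨I, rfl⟩
  have h := trace_word_mem_traceInvariants (List.ofFn I)
  simp only [List.map_ofFn, List.length_ofFn] at h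
  exact h
end

section
/- Let d ≥ 2. The functions g_i, for i = 0, 1, …, ⌊d/2⌋ − 1, from pairs of 2×2 complex matrices to ℂ given by g_i(A₀,A₁) = Tr(A₁·A₀^i·A₁·A₀^{d−2−i}), are linearly independent over ℂ in the vector space of ℂ-valued functions on pairs of 2×2 matrices. (Hence the weight-2 component of the linear span of uMPS(2,2,d) has dimension ⌊d/2⌋.) -/
open Matrix

/-- On `A₀ = diag(1, t)` and `A₁` the swap matrix, the trace is `t ^ i + t ^ k`. -/
lemma trace_swap_mul_diagonal_pow (t : ℂ) (i k : ℕ) :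
    ((!![0, 1; 1, 0] : Matrix (Fin 2) (Fin 2) ℂ) * diagonal ![1, t] ^ i * !![0, 1; 1, 0] *
      diagonal ![1, t] ^ k).trace = t ^ i + t ^ k := by
  simp only [diagonal_pow, trace_fin_two, Matrix.mul_apply, Fin.sum_univ_two, diagonal_apply]
  simp

/-- The functions `(A₀,A₁) ↦ Tr(A₁ A₀^i A₁ A₀^(d-2-i))`, `i = 0,…,⌊d/2⌋-1`, are linearly
independent. -/
theorem weight_two_linearly_independent (d : ℕ) (hd : 2 ≤ d) :
    LinearIndependent ℂ (fun i : Fin (d / 2) =>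
      fun p : Matrix (Fin 2) (Fin 2) ℂ × Matrix (Fin 2) (Fin 2) ℂ =>
        (p.2 * p.1 ^ (i : ℕ) * p.2 * p.1 ^ (d - 2 - (i : ℕ))).trace) := by
  rw [Fintype.linearIndependent_iff]
  intro c hc j
  have hP : ∑ i : Fin (d / 2), Polynomial.C (c i) *
      (Polynomial.X ^ (i : ℕ) + Polynomial.X ^ (d - 2 - (i : ℕ))) = 0 := by
    refine Polynomial.funext fun t => ?_
    have h := congrFun hc (diagonal ![1, t], !![0, 1; 1, 0])
    simp only [Finset.sum_apply, Pi.smul_apply, trace_swap_mul_diagonal_pow, smul_eq_mul,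
      Pi.zero_apply] at h
    simpa [Polynomial.eval_finsetSum] using h
  have h := congrArg (fun p => Polynomial.coeff p (j : ℕ)) hP
  simp only [Polynomial.finsetSum_coeff, Polynomial.coeff_C_mul, Polynomial.coeff_add,
    Polynomial.coeff_X_pow, Polynomial.coeff_zero] at h
  rw [Finset.sum_eq_single j] at h
  · rcases mul_eq_zero.mp h with h | h
    · exact h
    · split_ifs at h <;> norm_num at h
      all_goals contradiction
  · intro i _ hij
    have hne : (j : ℕ) ≠ i := fun e => hij (Fin.ext e.symm)
    have hi := i.isLt
    have hj := j.isLt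
    have hne' : (j : ℕ) ≠ d - 2 - i := by omega
    simp [hne, hne']
  · simp
end

section
/- Let d ≥ 6. Consider the functions from pairs of 2×2 complex matrices to ℂ given by f_b(A₀,A₁) = Tr(A₁²·A₀^b·A₁·A₀^{d−b−3}) for b ∈ {0,1,…,⌊(d−3)/2⌋}, and g_b(A₀,A₁) = Tr(A₁·A₀·A₁·A₀^b·A₁·A₀^{d−b−4}) for b ∈ {1,…,⌊(d−4)/2⌋}. These d − 3 functions are linearly independent over ℂ in the vector space of ℂ-valued functions on pairs of 2×2 matrices. -/
open Matrix

open Polynomial in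
/-- The palindromic polynomials `X ^ b + X ^ (m - b)` with `b ≤ m / 2` are linearly independent,
already as functions on a cofinite set. -/
theorem palindromic_coeff_eq_zero (m : ℕ) (e : Fin (m / 2 + 1) → ℂ)
    (h : ∀ y : ℂ, y ≠ 0 → y ≠ 1 → ∑ b, e b * (y ^ (b : ℕ) + y ^ (m - (b : ℕ))) = 0)
    (a : Fin (m / 2 + 1)) : e a = 0 := by
  have hP : ∑ b, C (e b) * (X ^ (b : ℕ) + X ^ (m - (b : ℕ))) = (0 : ℂ[X]) := by
    refine Polynomial.eq_zero_of_infinite_isRoot _ (Set.Infinite.mono ?_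
      (Set.toFinite ({0, 1} : Set ℂ)).infinite_compl)
    intro y hy
    simp only [Set.mem_compl_iff, Set.mem_insert_iff, Set.mem_singleton_iff, not_or] at hy
    simpa [Polynomial.eval_finsetSum] using h y hy.1 hy.2
  have hc := congrArg (fun p => p.coeff (a : ℕ)) hP
  simp only [finsetSum_coeff, coeff_C_mul, coeff_add, coeff_X_pow, coeff_zero] at hc
  rw [Finset.sum_eq_single a] at hc
  · rw [if_pos rfl] at hc
    split_ifs at hc
    · simpa using hc
    · simpa using hc
  · intro b _ hb
    have hab : (a : ℕ) ≠ b := fun h => hb (Fin.ext h.symm)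
    have hab' : (a : ℕ) ≠ m - b := by omega
    simp [hab, hab']
  · simp

/-- Traces of weight three words at `A₀ = diag(1, y)` and `A₁ = !![1, 1; t, 0]`. -/
theorem trace_weight_three (t y : ℂ) (i j k : ℕ) :
    (!![1, 1; t, 0] * diagonal ![1, y] ^ i * !![1, 1; t, 0] * diagonal ![1, y] ^ j
      * !![1, 1; t, 0] * diagonal ![1, y] ^ k).trace = 1 + t * (y ^ i + y ^ j + y ^ k) := by
  have hmul (l : ℕ) : !![1, 1; t, 0] * diagonal ![1, y] ^ l = !![1, y ^ l; t, 0] := by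
    rw [diagonal_pow]
    ext r s
    fin_cases r <;> fin_cases s <;> simp
  rw [hmul, Matrix.mul_assoc _ _ (diagonal ![1, y] ^ j), hmul,
    Matrix.mul_assoc _ _ (diagonal ![1, y] ^ k), hmul]
  simp [Matrix.trace_fin_two]
  ring

theorem coeff_eq_zero_of_sum_eq_zero (m : ℕ) (c : Fin ((m + 1) / 2 + 1) → ℂ)
    (e : Fin (m / 2) → ℂ) (hsum : ∑ b, c b + ∑ b, e b = 0)
    (h : ∀ y : ℂ, ∑ b, c b * (1 + y ^ (b : ℕ) + y ^ (m + 1 - (b : ℕ)))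
      + ∑ b, e b * (y + y ^ ((b : ℕ) + 1) + y ^ (m - ((b : ℕ) + 1))) = 0) :
    (∀ b, c b = 0) ∧ ∀ b, e b = 0 := by
  set s := ∑ b, c b with hs
  set F : ℂ → ℂ := fun y => ∑ b, c b * (y ^ (b : ℕ) + y ^ (m + 1 - (b : ℕ))) with hF
  set G : ℂ → ℂ := fun y => ∑ b, e b * (y ^ ((b : ℕ) + 1) + y ^ (m - ((b : ℕ) + 1))) with hG
  have hFG (y : ℂ) : s * (1 - y) + F y + G y = 0 := by
    have h1 : ∑ b, c b * (1 + y ^ (b : ℕ) + y ^ (m + 1 - (b : ℕ))) = s + F y := by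
      simp only [hs, hF, ← Finset.sum_add_distrib]
      exact Finset.sum_congr rfl fun b _ => by ring
    have h2 : ∑ b, e b * (y + y ^ ((b : ℕ) + 1) + y ^ (m - ((b : ℕ) + 1)))
        = (∑ b, e b) * y + G y := by
      simp only [hG, Finset.sum_mul, ← Finset.sum_add_distrib]
      exact Finset.sum_congr rfl fun b _ => by ring
    linear_combination h y - h1 - h2 - y * hsum
  have hrev (y : ℂ) (hy : y ≠ 0) {k l : ℕ} (hk : k ≤ l) : y ^ l * y⁻¹ ^ k = y ^ (l - k) := by
    rw [inv_pow, pow_sub₀ y hy hk]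
  have hFrev (y : ℂ) (hy : y ≠ 0) : y ^ (m + 1) * F y⁻¹ = F y := by
    simp only [hF, Finset.mul_sum]
    refine Finset.sum_congr rfl fun b _ => ?_
    have hb : (b : ℕ) ≤ m + 1 := by omega
    have h1 := hrev y hy hb
    have h2 := hrev y hy (Nat.sub_le (m + 1) b)
    rw [Nat.sub_sub_self hb] at h2
    linear_combination c b * (h1 + h2)
  have hGrev (y : ℂ) (hy : y ≠ 0) : y ^ m * G y⁻¹ = G y := by
    simp only [hG, Finset.mul_sum]
    refine Finset.sum_congr rfl fun b _ => ?_
    have hb : (b : ℕ) + 1 ≤ m := by omega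
    have h1 := hrev y hy hb
    have h2 := hrev y hy (Nat.sub_le m (b + 1))
    rw [Nat.sub_sub_self hb] at h2
    linear_combination e b * (h1 + h2)
  have hGs (y : ℂ) (hy : y ≠ 0) (hy1 : y ≠ 1) : s * (1 + y ^ m) + G y = 0 := by
    refine (mul_eq_zero.mp ?_).resolve_left (sub_ne_zero.mpr hy1.symm)
    linear_combination hFG y - y ^ (m + 1) * hFG y⁻¹ + hFrev y hy + y * hGrev y hy
      - s * y ^ m * mul_inv_cancel₀ hy
  have hcons := palindromic_coeff_eq_zero m (Fin.cons s e) fun y hy hy1 => by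
    simpa [Fin.sum_univ_succ, hG] using hGs y hy hy1
  have hs0 : s = 0 := hcons 0
  have he (b) : e b = 0 := by simpa using hcons b.succ
  refine ⟨palindromic_coeff_eq_zero (m + 1) c fun y _ _ => ?_, he⟩
  have hG0 : G y = 0 := by simp [hG, he]
  change F y = 0
  linear_combination hFG y - (1 - y) * hs0 - hG0

/-- The `d - 3` functions `f_b(A₀,A₁) = Tr(A₁² A₀^b A₁ A₀^(d-b-3))` for
`b ∈ {0,…,⌊(d-3)/2⌋}` and `g_b(A₀,A₁) = Tr(A₁ A₀ A₁ A₀^b A₁ A₀^(d-b-4))` for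
`b ∈ {1,…,⌊(d-4)/2⌋}` are linearly independent. -/
theorem weight_three_linearly_independent (d : ℕ) (hd : 6 ≤ d) :
    LinearIndependent ℂ
      (Sum.elim
        (fun b : Fin ((d - 3) / 2 + 1) =>
          fun p : Matrix (Fin 2) (Fin 2) ℂ × Matrix (Fin 2) (Fin 2) ℂ =>
            (p.2 * p.2 * p.1 ^ (b : ℕ) * p.2 * p.1 ^ (d - (b : ℕ) - 3)).trace)
        (fun b : Fin ((d - 4) / 2) =>
          fun p : Matrix (Fin 2) (Fin 2) ℂ × Matrix (Fin 2) (Fin 2) ℂ =>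
            (p.2 * p.1 * p.2 * p.1 ^ ((b : ℕ) + 1) * p.2
              * p.1 ^ (d - ((b : ℕ) + 1) - 4)).trace)) := by
  obtain ⟨m, rfl⟩ : ∃ m, d = m + 4 := ⟨d - 4, by omega⟩
  rw [Fintype.linearIndependent_iff]
  intro g hg
  have key (t y : ℂ) :
      ∑ b : Fin ((m + 1) / 2 + 1),
        g (Sum.inl b) * (1 + t * (1 + y ^ (b : ℕ) + y ^ (m + 1 - (b : ℕ))))
      + ∑ b : Fin (m / 2),
        g (Sum.inr b) * (1 + t * (y + y ^ ((b : ℕ) + 1) + y ^ (m - ((b : ℕ) + 1)))) = 0 := by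
    have h := congrFun hg (diagonal ![1, y], !![1, 1; t, 0])
    rw [Fintype.sum_sum_type] at h
    simp only [Sum.elim_inl, Sum.elim_inr, Pi.add_apply, Finset.sum_apply, Pi.smul_apply,
      smul_eq_mul, Pi.zero_apply] at h
    rw [← h]
    congr 1
    · refine Finset.sum_congr rfl fun b _ => ?_
      have h0 := trace_weight_three t y 0 b (m + 4 - b - 3)
      rw [pow_zero, Matrix.mul_one, pow_zero] at h0
      rw [h0, show m + 4 - (b : ℕ) - 3 = m + 1 - b by omega]
    · refine Finset.sum_congr rfl fun b _ => ?_
      have h1 := trace_weight_three t y 1 (b + 1) (m + 4 - (b + 1) - 4)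
      rw [pow_one, pow_one] at h1
      rw [h1, show m + 4 - ((b : ℕ) + 1) - 4 = m - (b + 1) by omega]
  have hsum : ∑ b : Fin ((m + 1) / 2 + 1), g (Sum.inl b) + ∑ b : Fin (m / 2), g (Sum.inr b) = 0 := by
    simpa using key 0 0
  obtain ⟨hf, hg'⟩ := coeff_eq_zero_of_sum_eq_zero m (fun b => g (Sum.inl b))
    (fun b => g (Sum.inr b)) hsum fun y => by
      have h := key 1 y
      simp only [mul_add, mul_one, one_mul, Finset.sum_add_distrib] at h hsum ⊢
      linear_combination h - hsum
  rintro (b | b)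
  · exact hf b
  · exact hg' b
end

section
/- Let a ≥ 1 and b, c ≥ 0 be natural numbers. For all 2×2 complex matrices A₀ and A₁, the following identity holds: Tr(A₁A₀^{a−1}A₁A₀^{b+1}A₁A₀^c) + Tr(A₁A₀^bA₁A₀A₁A₀^{a+c−1}) + Tr(A₁²A₀^aA₁A₀^{b+c}) = Tr(A₁A₀^aA₁A₀^bA₁A₀^c) + Tr(A₁A₀^{b+1}A₁²A₀^{a+c−1}) + Tr(A₁A₀A₁A₀^{a−1}A₁A₀^{b+c}). -/
open Matrix

theorem Matrix.exists_pow_eq_smul_one_add_smul {R : Type*} [CommRing R]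
    (A : Matrix (Fin 2) (Fin 2) R) (n : ℕ) : ∃ p q : R, A ^ n = p • 1 + q • A := by
  induction n with
  | zero => exact ⟨1, 0, by simp⟩
  | succ n ih =>
    obtain ⟨p, q, h⟩ := ih
    refine ⟨-(q * A.det), p + q * A.trace, ?_⟩
    rw [pow_succ, h]
    ext i j
    fin_cases i <;> fin_cases j <;>
      simp [Matrix.mul_apply, Fin.sum_univ_two, Matrix.det_fin_two, Matrix.trace_fin_two,
        Matrix.one_apply] <;> ring

/-- The trace identity used in the induction for the weight-3 spanning result. -/
theorem weight_three_trace_identity (a b c : ℕ) (ha : 1 ≤ a)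
    (A₀ A₁ : Matrix (Fin 2) (Fin 2) ℂ) :
    (A₁ * A₀ ^ (a - 1) * A₁ * A₀ ^ (b + 1) * A₁ * A₀ ^ c).trace
        + (A₁ * A₀ ^ b * A₁ * A₀ * A₁ * A₀ ^ (a + c - 1)).trace
        + (A₁ * A₁ * A₀ ^ a * A₁ * A₀ ^ (b + c)).trace
      = (A₁ * A₀ ^ a * A₁ * A₀ ^ b * A₁ * A₀ ^ c).trace
        + (A₁ * A₀ ^ (b + 1) * A₁ * A₁ * A₀ ^ (a + c - 1)).trace
        + (A₁ * A₀ * A₁ * A₀ ^ (a - 1) * A₁ * A₀ ^ (b + c)).trace := by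
  obtain ⟨m, rfl⟩ := Nat.exists_eq_add_of_le' ha
  have hmc : m + 1 + c - 1 = m + c := by lia
  obtain ⟨p, q, hm⟩ := A₀.exists_pow_eq_smul_one_add_smul m
  obtain ⟨r, s, hb⟩ := A₀.exists_pow_eq_smul_one_add_smul b
  obtain ⟨t, u, hc⟩ := A₀.exists_pow_eq_smul_one_add_smul c
  rw [hmc, Nat.add_sub_cancel, pow_succ, pow_succ, pow_add _ m, pow_add _ b, hm, hb, hc]
  simp only [mul_add, add_mul, smul_mul_assoc, mul_smul_comm, mul_one, one_mul, trace_add,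
    trace_smul, smul_eq_mul, ← mul_assoc]
  simp only [trace_fin_two, Matrix.mul_apply, Fin.sum_univ_two]
  ring
end
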